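/- Every finite distributive lattice D with at most 7 elements is fully representable. -/

import Mathlib

/-- A congruence of a lattice: an equivalence relation compatible with `⊔` and `⊓`. -/
structure LatCon (L : Type*) [Lattice L] where
  r : L → L → Prop
  refl : ∀ a, r a a
  symm : ∀ {a b}, r a b → r b a
  trans : ∀ {a b c}, r a b → r b c → r a c
  sup_comp : ∀ {a b c d}, r a b → r c d → r (a ⊔ c) (b ⊔ d)
  inf_comp : ∀ {a b c d}, r a b → r c d → r (a ⊓ c) (b ⊓ d)

namespace LatCon

variable {L : Type*} [Lattice L]

theorem ext' {θ ψ : LatCon L} (h : ∀ a b, θ.r a b ↔ ψ.r a b) : θ = ψ := by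
  cases θ; cases ψ
  simp only [mk.injEq]
  funext a b
  exact propext (h a b)

/-- Congruences are ordered by containment. -/
instance : PartialOrder (LatCon L) where
  le θ ψ := ∀ a b, θ.r a b → ψ.r a b
  le_refl θ := fun _ _ h => h
  le_trans θ ψ χ h1 h2 := fun a b h => h2 a b (h1 a b h)
  le_antisymm θ ψ h1 h2 := ext' fun a b => ⟨h1 a b, h2 a b⟩

instance : InfSet (LatCon L) where
  sInf S :=
    { r := fun a b => ∀ θ ∈ S, θ.r a b
      refl := fun a θ _ => θ.refl a
      symm := fun h θ hθ => θ.symm (h θ hθ)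
      trans := fun h1 h2 θ hθ => θ.trans (h1 θ hθ) (h2 θ hθ)
      sup_comp := fun h1 h2 θ hθ => θ.sup_comp (h1 θ hθ) (h2 θ hθ)
      inf_comp := fun h1 h2 θ hθ => θ.inf_comp (h1 θ hθ) (h2 θ hθ) }

/-- `Con L`, the lattice of congruences of `L`, is a complete lattice. -/
instance : CompleteLattice (LatCon L) :=
  completeLatticeOfInf (LatCon L) fun S =>
    ⟨fun θ hθ a b h => h θ hθ, fun ψ hψ a b h θ hθ => hψ hθ a b h⟩

/-- The principal congruence `con(a, b)`: the smallest congruence collapsing `a` and `b`. -/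
def princ (a b : L) : LatCon L := sInf {θ : LatCon L | θ.r a b}

/-- A congruence is principal if it is of the form `con(a, b)`. -/
def IsPrincipal (θ : LatCon L) : Prop := ∃ a b : L, θ = princ a b

end LatCon

/-- `Princ L`, the set of principal congruences of a lattice `L`,
ordered by containment (the order inherited from `Con L`). -/
def Princ (L : Type*) [Lattice L] : Set (LatCon L) := {θ : LatCon L | θ.IsPrincipal}

/-- `J⁺(D) = {⊥, ⊤} ∪ J(D)`, where `J(D)` is the set of join-irreducible elements. -/
def Jplus (D : Type*) [Lattice D] [BoundedOrder D] : Set D :=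
  {⊥, ⊤} ∪ {x : D | SupIrred x}

/-- `Q ⊆ D` is principal congruence representable: there are a finite lattice `L` and
an order isomorphism `φ : Con L ≃o D` mapping `Princ L` exactly onto `Q`. -/
def Representable (D : Type*) [Lattice D] (Q : Set D) : Prop :=
  ∃ (L : Type) (_ : Lattice L) (_ : Fintype L) (φ : LatCon L ≃o D),
    φ '' Princ L = Q

/-- `D` is fully representable: every candidate `J⁺(D) ⊆ Q ⊆ D` is representable. -/
def FullyRepresentable (D : Type*) [Lattice D] [BoundedOrder D] : Prop :=
  ∀ Q : Set D, Jplus D ⊆ Q → Representable D Q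

universe u

namespace LatCon

variable {L : Type*} [Lattice L]

theorem princ_le_iff {a b : L} {θ : LatCon L} : princ a b ≤ θ ↔ θ.r a b :=
  ⟨fun h => h a b fun _ hψ => hψ, fun h => sInf_le h⟩

theorem r_inf_sup_iff (θ : LatCon L) {x y : L} : θ.r (x ⊓ y) (x ⊔ y) ↔ θ.r x y := by
  constructor
  · intro h
    have hx : θ.r x (x ⊔ y) := by simpa using θ.sup_comp h (θ.refl x)
    have hy : θ.r y (x ⊔ y) := by simpa using θ.sup_comp h (θ.refl y)
    exact θ.trans hx (θ.symm hy)
  · intro h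
    have h₁ : θ.r (x ⊓ y) y := by simpa using θ.inf_comp h (θ.refl y)
    have h₂ : θ.r (x ⊔ y) y := by simpa using θ.sup_comp h (θ.refl y)
    exact θ.trans h₁ (θ.symm h₂)

theorem r_of_le_of_le (θ : LatCon L) {a b x y : L} (h : θ.r a b) (hax : a ≤ x) (hxy : x ≤ y)
    (hyb : y ≤ b) : θ.r x y := by
  have h₁ : θ.r x b := by
    simpa [sup_eq_right.2 hax, sup_eq_left.2 (hxy.trans hyb)] using θ.sup_comp h (θ.refl x)
  simpa [inf_eq_left.2 hxy, inf_eq_right.2 hyb] using θ.inf_comp h₁ (θ.refl y)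

theorem r_iff_of_le_of_le (θ : LatCon L) {x y z : L} (hxz : x ≤ z) (hzy : z ≤ y) :
    θ.r x y ↔ θ.r x z ∧ θ.r z y :=
  ⟨fun h => ⟨θ.r_of_le_of_le h le_rfl hxz hzy, θ.r_of_le_of_le h hxz hzy le_rfl⟩,
    fun h => θ.trans h.1 h.2⟩

/-- The congruence induced along a lattice homomorphism. -/
def comap {K : Type*} [Lattice K] (θ : LatCon L) (f : LatticeHom K L) : LatCon K where
  r x y := θ.r (f x) (f y)
  refl _ := θ.refl _
  symm h := θ.symm h
  trans h h' := θ.trans h h'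
  sup_comp h h' := by simpa using θ.sup_comp h h'
  inf_comp h h' := by simpa using θ.inf_comp h h'

end LatCon

/-- A `D`-valued colouring `c` of the pairs of elements of `L` such that `d ↦ {(x, y) | c x y ≤ d}`
is an order isomorphism from `D` onto the congruences of `L`. -/
structure IsColoring {L D : Type*} [Lattice L] [Lattice D] (c : L → L → D) : Prop where
  exists_latCon : ∀ d, ∃ θ : LatCon L, ∀ x y, θ.r x y ↔ c x y ≤ d
  exists_value : ∀ θ : LatCon L, ∃ d, ∀ x y, θ.r x y ↔ c x y ≤ d
  dense : ∀ d e, (∀ x y, c x y ≤ d → c x y ≤ e) → d ≤ e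

/-- A set is representable iff it is the set of values of a colouring of a finite lattice. -/
theorem representable_iff {D : Type*} [Lattice D] {Q : Set D} :
    Representable D Q ↔ ∃ (L : Type) (_ : Lattice L) (_ : Fintype L) (c : L → L → D),
      IsColoring c ∧ ∀ d, d ∈ Q ↔ ∃ x y, c x y = d := by
  constructor
  · rintro ⟨L, _, _, φ, rfl⟩
    have key (θ : LatCon L) (x y : L) : θ.r x y ↔ φ (LatCon.princ x y) ≤ φ θ := by
      rw [φ.le_iff_le, LatCon.princ_le_iff]
    refine ⟨L, _, ‹_›, fun x y => φ (LatCon.princ x y), ⟨fun d => ⟨φ.symm d, fun x y => ?_⟩,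
      fun θ => ⟨φ θ, key θ⟩, fun d e h => ?_⟩, fun d => ?_⟩
    · simp [key]
    · have : φ.symm d ≤ φ.symm e := fun x y hxy => by
        rw [key, φ.apply_symm_apply] at hxy ⊢
        exact h x y hxy
      exact φ.symm.le_iff_le.1 this
    · constructor
      · rintro ⟨_, ⟨x, y, rfl⟩, rfl⟩
        exact ⟨x, y, rfl⟩
      · rintro ⟨x, y, rfl⟩
        exact ⟨_, ⟨x, y, rfl⟩, rfl⟩
  · rintro ⟨L, _, _, c, hc, hQ⟩
    choose θ hθ using hc.exists_latCon
    have hle (d e : D) : θ d ≤ θ e ↔ d ≤ e := by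
      refine ⟨fun h => hc.dense d e fun x y => ?_, fun h x y => ?_⟩
      · rw [← hθ, ← hθ]
        exact h x y
      · rw [hθ, hθ]
        exact fun h' => h'.trans h
    have hprinc (x y : L) : θ (c x y) = LatCon.princ x y := by
      apply le_antisymm
      · obtain ⟨d, hd⟩ := hc.exists_value (LatCon.princ x y)
        have hxy := (hd x y).1 (LatCon.princ_le_iff.1 le_rfl)
        intro a b hab
        rw [hθ] at hab
        exact (hd a b).2 (hab.trans hxy)
      · rw [LatCon.princ_le_iff, hθ]
    have hsurj : Function.Surjective θ := fun ψ => by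
      obtain ⟨d, hd⟩ := hc.exists_value ψ
      exact ⟨d, LatCon.ext' fun a b => by rw [hθ, hd]⟩
    let ψ : D ≃o LatCon L :=
      RelIso.ofSurjective (OrderEmbedding.ofMapLEIff θ hle) hsurj
    have hψ (d : D) : ψ d = θ d := rfl
    refine ⟨L, _, ‹_›, ψ.symm, Set.ext fun d => ?_⟩
    rw [hQ]
    constructor
    · rintro ⟨_, ⟨x, y, rfl⟩, rfl⟩
      exact ⟨x, y, by rw [← hprinc, ← hψ, ψ.symm_apply_apply]⟩
    · rintro ⟨x, y, rfl⟩
      exact ⟨_, ⟨x, y, rfl⟩, by rw [← hprinc, ← hψ, ψ.symm_apply_apply]⟩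

/-- The lattice `L` together with a new least and a new greatest element and two further elements,
each of which is a complement of every other element strictly between the new bounds. -/
inductive Hat (L : Type*)
  | bot | top | left | right
  | mid (x : L)

namespace Hat

variable {L : Type*}

noncomputable instance [Fintype L] : Fintype (Hat L) := by
  classical
  refine Fintype.ofSurjective (fun o : Fin 4 ⊕ L => o.elim (![bot, top, left, right]) mid) ?_
  rintro (_ | _ | _ | _ | x)
  exacts [⟨.inl 0, rfl⟩, ⟨.inl 1, rfl⟩, ⟨.inl 2, rfl⟩, ⟨.inl 3, rfl⟩, ⟨.inr x, rfl⟩]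

variable [Lattice L]

/-- The join of `Hat L`. -/
def join : Hat L → Hat L → Hat L
  | bot, q => q
  | p, bot => p
  | left, left => left
  | right, right => right
  | mid x, mid y => mid (x ⊔ y)
  | _, _ => top

/-- The meet of `Hat L`. -/
def meet : Hat L → Hat L → Hat L
  | top, q => q
  | p, top => p
  | left, left => left
  | right, right => right
  | mid x, mid y => mid (x ⊓ y)
  | _, _ => bot

instance : Max (Hat L) := ⟨join⟩
instance : Min (Hat L) := ⟨meet⟩

theorem sup_def (p q : Hat L) : p ⊔ q = join p q := rfl
theorem inf_def (p q : Hat L) : p ⊓ q = meet p q := rfl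

instance : Lattice (Hat L) :=
  Lattice.mk'
    (by rintro (_ | _ | _ | _ | x) (_ | _ | _ | _ | y) <;> simp [sup_def, join, sup_comm])
    (by rintro (_ | _ | _ | _ | x) (_ | _ | _ | _ | y) (_ | _ | _ | _ | z) <;>
      simp [sup_def, join, sup_assoc])
    (by rintro (_ | _ | _ | _ | x) (_ | _ | _ | _ | y) <;> simp [inf_def, meet, inf_comm])
    (by rintro (_ | _ | _ | _ | x) (_ | _ | _ | _ | y) (_ | _ | _ | _ | z) <;>
      simp [inf_def, meet, inf_assoc])
    (by rintro (_ | _ | _ | _ | x) (_ | _ | _ | _ | y) <;> simp [inf_def, sup_def, meet, join])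
    (by rintro (_ | _ | _ | _ | x) (_ | _ | _ | _ | y) <;> simp [inf_def, sup_def, meet, join])

/-- The embedding of `L` into `Hat L`. -/
def midHom : LatticeHom L (Hat L) where
  toFun := mid
  map_sup' _ _ := rfl
  map_inf' _ _ := rfl

theorem r_of_r_bot_top {θ : LatCon (Hat L)} (h : θ.r bot top) (p q : Hat L) : θ.r p q := by
  have key (p : Hat L) : θ.r p top := by
    have := θ.sup_comp h (θ.refl p)
    cases p <;> exact this
  exact θ.trans (key p) (θ.symm (key q))

theorem r_bot_top_of_r_bot [Nonempty L] {θ : LatCon (Hat L)} {q : Hat L} (hq : q ≠ bot)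
    (h : θ.r bot q) : θ.r bot top := by
  obtain ⟨y⟩ := ‹Nonempty L›
  have key (z w : Hat L) (hz : z ⊔ q = top) (hw : w ⊔ q = top) (hzw : z ⊓ w = bot) :
      θ.r bot top := by
    have bot_sup (z : Hat L) : bot ⊔ z = z := by cases z <;> rfl
    have h₁ := θ.sup_comp h (θ.refl z)
    have h₂ := θ.sup_comp h (θ.refl w)
    rw [bot_sup, sup_comm q] at h₁ h₂
    simpa [hz, hw, hzw] using θ.inf_comp h₁ h₂
  cases q with
  | bot => exact absurd rfl hq
  | top => exact h
  | left => exact key right (mid y) rfl rfl rfl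
  | right => exact key left (mid y) rfl rfl rfl
  | mid x => exact key left right rfl rfl rfl

theorem r_bot_top_of_r_top [Nonempty L] {θ : LatCon (Hat L)} {q : Hat L} (hq : q ≠ top)
    (h : θ.r q top) : θ.r bot top := by
  obtain ⟨y⟩ := ‹Nonempty L›
  have key (z w : Hat L) (hz : z ⊓ q = bot) (hw : w ⊓ q = bot) (hzw : z ⊔ w = top) :
      θ.r bot top := by
    have top_inf (z : Hat L) : top ⊓ z = z := by cases z <;> rfl
    have h₁ := θ.inf_comp h (θ.refl z)
    have h₂ := θ.inf_comp h (θ.refl w)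
    rw [top_inf, inf_comm q] at h₁ h₂
    simpa [hz, hw, hzw] using θ.sup_comp h₁ h₂
  cases q with
  | bot => exact h
  | top => exact absurd rfl hq
  | left => exact key right (mid y) rfl rfl rfl
  | right => exact key left (mid y) rfl rfl rfl
  | mid x => exact key left right rfl rfl rfl

/-- A congruence of `Hat L` that does not come from `L` is total. -/
theorem r_of_r [Nonempty L] {θ : LatCon (Hat L)} {p q : Hat L} (hne : p ≠ q)
    (hmid : ∀ x y, p = mid x → q ≠ mid y) (h : θ.r p q) (a b : Hat L) : θ.r a b := by
  refine r_of_r_bot_top ?_ a b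
  have h' := θ.r_inf_sup_iff.2 h
  rcases p with _ | _ | _ | _ | x <;> rcases q with _ | _ | _ | _ | y
  any_goals exact absurd rfl hne
  any_goals exact h'
  any_goals exact r_bot_top_of_r_bot (by simp) h
  any_goals exact r_bot_top_of_r_bot (by simp) (θ.symm h)
  any_goals exact r_bot_top_of_r_top (by simp) h
  any_goals exact r_bot_top_of_r_top (by simp) (θ.symm h)
  exact absurd rfl (hmid x y rfl)

/-- The extension of a congruence of `L` by singletons. -/
def lift (θ : LatCon L) : LatCon (Hat L) where
  r p q := p = q ∨ ∃ x y, p = mid x ∧ q = mid y ∧ θ.r x y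
  refl _ := .inl rfl
  symm := by
    rintro _ _ (rfl | ⟨x, y, rfl, rfl, h⟩)
    exacts [.inl rfl, .inr ⟨y, x, rfl, rfl, θ.symm h⟩]
  trans := by
    rintro _ _ _ (rfl | ⟨x, y, rfl, rfl, h⟩) (rfl | ⟨x', y', h₁, rfl, h'⟩)
    · exact .inl rfl
    · exact .inr ⟨x', y', h₁, rfl, h'⟩
    · exact .inr ⟨x, y, rfl, rfl, h⟩
    · cases h₁
      exact .inr ⟨x, y', rfl, rfl, θ.trans h h'⟩
  sup_comp := by
    rintro _ _ p _ (rfl | ⟨x, y, rfl, rfl, h⟩) (rfl | ⟨x', y', rfl, rfl, h'⟩)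
    · exact .inl rfl
    · rename_i p
      cases p <;> first
        | exact .inl rfl
        | exact .inr ⟨_, _, rfl, rfl, θ.sup_comp (θ.refl _) h'⟩
        | exact .inr ⟨_, _, rfl, rfl, h'⟩
    · cases p <;> first
        | exact .inl rfl
        | exact .inr ⟨_, _, rfl, rfl, θ.sup_comp h (θ.refl _)⟩
        | exact .inr ⟨_, _, rfl, rfl, h⟩
    · exact .inr ⟨_, _, rfl, rfl, θ.sup_comp h h'⟩
  inf_comp := by
    rintro _ _ p _ (rfl | ⟨x, y, rfl, rfl, h⟩) (rfl | ⟨x', y', rfl, rfl, h'⟩)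
    · exact .inl rfl
    · rename_i p
      cases p <;> first
        | exact .inl rfl
        | exact .inr ⟨_, _, rfl, rfl, θ.inf_comp (θ.refl _) h'⟩
        | exact .inr ⟨_, _, rfl, rfl, h'⟩
    · cases p <;> first
        | exact .inl rfl
        | exact .inr ⟨_, _, rfl, rfl, θ.inf_comp h (θ.refl _)⟩
        | exact .inr ⟨_, _, rfl, rfl, h⟩
    · exact .inr ⟨_, _, rfl, rfl, θ.inf_comp h h'⟩

end Hat

/-- The total congruence. -/
def LatCon.total (L : Type*) [Lattice L] : LatCon L where
  r _ _ := True
  refl _ := trivial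
  symm _ := trivial
  trans _ _ := trivial
  sup_comp _ _ := trivial
  inf_comp _ _ := trivial

/-- If `D` has a largest element `u` below `⊤` and `u ∈ Q`, then representability passes from
`Iic u` to `D`. -/
theorem Representable.of_Iic {D : Type*} [Lattice D] [BoundedOrder D] {Q : Set D} {u : D}
    (hu : u ≠ ⊤) (hle : ∀ d, d ≠ ⊤ → d ≤ u) (huQ : u ∈ Q) (htop : ⊤ ∈ Q)
    (h : Representable (Set.Iic u) {d | (d : D) ∈ Q}) : Representable D Q := by
  classical
  rw [representable_iff] at h ⊢
  obtain ⟨L, _, _, c, hc, hQ⟩ := h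
  have : Nonempty L := by
    obtain ⟨x, _⟩ := (hQ ⟨u, le_rfl⟩).1 huQ
    exact ⟨x⟩
  let C : Hat L → Hat L → D := fun p q => if p = q then ⊥ else
    match p, q with
    | .mid x, .mid y => c x y
    | _, _ => ⊤
  have hself (x : L) : c x x = ⊥ := by
    obtain ⟨θ, hθ⟩ := hc.exists_latCon ⊥
    exact le_bot_iff.1 ((hθ x x).1 (θ.refl x))
  have hCmid (x y : L) : C (.mid x) (.mid y) = c x y := by
    by_cases h : x = y
    · subst h
      simp [C, hself]
    · simp [C, h]
  have hCself (p : Hat L) : C p p = ⊥ := by simp [C]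
  have hC (p q : Hat L) (hne : p ≠ q) (hmid : ∀ x y, p = .mid x → q ≠ .mid y) : C p q = ⊤ := by
    simp only [C, if_neg hne]
  refine ⟨Hat L, inferInstance, inferInstance, C, ⟨fun d => ?_, fun θ => ?_, fun d e hde => ?_⟩,
    fun d => ?_⟩
  · by_cases hd : d = ⊤
    · exact ⟨.total _, fun x y => by simp [LatCon.total, hd]⟩
    · obtain ⟨θ, hθ⟩ := hc.exists_latCon ⟨d, hle d hd⟩
      refine ⟨Hat.lift θ, fun p q => ?_⟩
      by_cases hpq : p = q
      · subst hpq
        simp [hCself, (Hat.lift θ).refl]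
      by_cases hmid : ∃ x y, p = .mid x ∧ q = .mid y
      · obtain ⟨x, y, rfl, rfl⟩ := hmid
        have : x ≠ y := fun h => hpq (by rw [h])
        simp only [Hat.lift, hCmid, Hat.mid.injEq, this, false_or]
        simpa [← Subtype.coe_le_coe] using hθ x y
      · rw [hC p q hpq fun x y hx hy => hmid ⟨x, y, hx, hy⟩, top_le_iff]
        simp only [hd, iff_false]
        rintro (h | ⟨x, y, hx, hy, -⟩)
        exacts [hpq h, hmid ⟨x, y, hx, hy⟩]
  · by_cases hθ : ∃ p q, p ≠ q ∧ (∀ x y, p = .mid x → q ≠ .mid y) ∧ θ.r p q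
    · obtain ⟨p, q, hne, hmid, h⟩ := hθ
      exact ⟨⊤, fun a b => by simp [Hat.r_of_r hne hmid h a b]⟩
    · push Not at hθ
      obtain ⟨d, hd⟩ := hc.exists_value (θ.comap Hat.midHom)
      refine ⟨d, fun p q => ?_⟩
      by_cases hpq : p = q
      · subst hpq
        simp [hCself, θ.refl]
      by_cases hmid : ∃ x y, p = .mid x ∧ q = .mid y
      · obtain ⟨x, y, rfl, rfl⟩ := hmid
        rw [hCmid, Subtype.coe_le_coe, ← hd]
        rfl
      · have hmid' : ∀ x y, p = .mid x → q ≠ .mid y := fun x y hx hy => hmid ⟨x, y, hx, hy⟩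
        rw [hC p q hpq hmid', top_le_iff]
        have : (d : D) ≠ ⊤ := fun h => hu (top_le_iff.1 (h ▸ d.2))
        simp [this, hθ p q hpq hmid']
  · have h₁ : ⊤ ≤ d → ⊤ ≤ e := by
      have := hde .bot .top
      rwa [hC _ _ (by simp) (by simp)] at this
    by_cases hd : d = ⊤
    · simp [top_le_iff.1 (h₁ hd.ge)]
    by_cases he : e = ⊤
    · simp [he]
    have := hc.dense ⟨d, hle d hd⟩ ⟨e, hle e he⟩ fun x y hxy => by
      have := hde (.mid x) (.mid y)
      rw [hCmid] at this
      exact this hxy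
    exact this
  · by_cases hd : d = ⊤
    · subst hd
      simp only [htop, true_iff]
      exact ⟨.bot, .top, hC _ _ (by simp) (by simp)⟩
    · have := hQ ⟨d, hle d hd⟩
      rw [Set.mem_ofPred_eq] at this
      rw [this]
      constructor
      · rintro ⟨x, y, h⟩
        exact ⟨.mid x, .mid y, by rw [hCmid, h]⟩
      · rintro ⟨p, q, h⟩
        by_cases hpq : p = q
        · subst hpq
          obtain ⟨x⟩ := ‹Nonempty L›
          refine ⟨x, x, Subtype.ext (Eq.trans ?_ h)⟩
          rw [hCself, hself, Set.Iic.coe_bot]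
        by_cases hmid : ∃ x y, p = .mid x ∧ q = .mid y
        · obtain ⟨x, y, rfl, rfl⟩ := hmid
          exact ⟨x, y, Subtype.ext ((hCmid x y).symm.trans h)⟩
        · exact absurd (h ▸ hC p q hpq fun x y hx hy => hmid ⟨x, y, hx, hy⟩) hd

/-- The equality congruence. -/
def LatCon.diag (L : Type*) [Lattice L] : LatCon L where
  r := Eq
  refl := Eq.refl
  symm := Eq.symm
  trans := Eq.trans
  sup_comp h h' := by rw [h, h']
  inf_comp h h' := by rw [h, h']

namespace Hat

instance {L : Type*} [Lattice L] : BoundedOrder (Hat L) where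
  bot := bot
  top := top
  bot_le p := sup_eq_right.1 (by cases p <;> rfl)
  le_top p := inf_eq_left.1 (by cases p <;> rfl)

instance {L : Type*} [Lattice L] : Nontrivial (Hat L) := ⟨bot, top, by simp⟩

end Hat

/-- The lattice obtained from `L` by replacing each element by a copy of the five-element modular
nondistributive lattice, where comparable copies are glued along their bounds only. It is
subdirectly irreducible, and `L` is its quotient by the monolith. -/
structure Twist (L : Type*) where
  base : L
  fib : Hat Unit

namespace Twist

open Classical in
/-- The join homomorphism from the copy over `x` to the copy over `y`, for `x ≤ y`. -/
noncomputable def push {L : Type*} (x y : L) (s : Hat Unit) : Hat Unit :=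
  if x = y then s else if s = ⊥ then ⊥ else ⊤

open Classical in
/-- The meet homomorphism from the copy over `y` to the copy over `x`, for `x ≤ y`. -/
noncomputable def pull {L : Type*} (x y : L) (s : Hat Unit) : Hat Unit :=
  if x = y then s else if s = ⊤ then ⊤ else ⊥

section

variable {L : Type*} (x y z : L) (s t : Hat Unit)

theorem push_le_iff : push x y s ≤ t ↔ s ≤ pull x y t := by
  unfold push pull
  split_ifs <;> simp_all

@[simp] theorem push_self : push x x s = s := by simp [push]
@[simp] theorem pull_self : pull x x s = s := by simp [pull]
@[simp] theorem push_bot : push x y ⊥ = ⊥ := by simp [push]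
@[simp] theorem push_top : push x y ⊤ = ⊤ := by simp [push]
@[simp] theorem pull_bot : pull x y ⊥ = ⊥ := by simp [pull]
@[simp] theorem pull_top : pull x y ⊤ = ⊤ := by simp [pull]

variable {x y z}

theorem push_push [PartialOrder L] (hxy : x ≤ y) (hyz : y ≤ z) :
    push y z (push x y s) = push x z s := by
  rcases hxy.eq_or_lt with rfl | hxy
  · simp
  rcases hyz.eq_or_lt with rfl | hyz
  · simp
  by_cases hs : s = ⊥ <;> simp [push, hxy.ne, hyz.ne, (hxy.trans hyz).ne, hs]

theorem pull_pull [PartialOrder L] (hxy : x ≤ y) (hyz : y ≤ z) :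
    pull x y (pull y z s) = pull x z s :=
  eq_of_forall_le_iff fun t => by simp only [← push_le_iff, push_push t hxy hyz]

end

variable {L : Type*}

noncomputable instance [Fintype L] : Fintype (Twist L) := by
  classical
  exact Fintype.ofSurjective (fun p : L × Hat Unit => (⟨p.1, p.2⟩ : Twist L))
    fun p => ⟨(p.base, p.fib), rfl⟩

variable [Lattice L]

instance : PartialOrder (Twist L) where
  le p q := p.base ≤ q.base ∧ push p.base q.base p.fib ≤ q.fib
  le_refl p := by simp
  le_trans p q r h h' := by
    refine ⟨h.1.trans h'.1, ?_⟩
    rw [← push_push _ h.1 h'.1, push_le_iff]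
    exact h.2.trans ((push_le_iff ..).1 h'.2)
  le_antisymm := by
    rintro ⟨x, s⟩ ⟨y, t⟩ ⟨h, hs⟩ ⟨h', ht⟩
    obtain rfl : x = y := le_antisymm h h'
    simp only [push_self] at hs ht
    rw [le_antisymm hs ht]

theorem le_def {p q : Twist L} : p ≤ q ↔ p.base ≤ q.base ∧ push p.base q.base p.fib ≤ q.fib :=
  Iff.rfl

theorem le_def' {p q : Twist L} : p ≤ q ↔ p.base ≤ q.base ∧ p.fib ≤ pull p.base q.base q.fib := by
  rw [le_def, push_le_iff]

noncomputable instance : Lattice (Twist L) where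
  sup p q := ⟨p.base ⊔ q.base,
    push p.base (p.base ⊔ q.base) p.fib ⊔ push q.base (p.base ⊔ q.base) q.fib⟩
  inf p q := ⟨p.base ⊓ q.base,
    pull (p.base ⊓ q.base) p.base p.fib ⊓ pull (p.base ⊓ q.base) q.base q.fib⟩
  le_sup_left p q := ⟨le_sup_left, le_sup_left⟩
  le_sup_right p q := ⟨le_sup_right, le_sup_right⟩
  sup_le p q r hp hq := by
    rw [le_def']
    refine ⟨sup_le hp.1 hq.1, sup_le ?_ ?_⟩ <;> rw [← push_le_iff, push_push]
    exacts [hp.2, le_sup_left, sup_le hp.1 hq.1, hq.2, le_sup_right, sup_le hp.1 hq.1]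
  inf_le_left p q := le_def'.2 ⟨inf_le_left, inf_le_left⟩
  inf_le_right p q := le_def'.2 ⟨inf_le_right, inf_le_right⟩
  le_inf p q r hp hq := by
    rw [le_def'] at hp hq
    refine ⟨le_inf hp.1 hq.1, le_inf ?_ ?_⟩ <;> rw [push_le_iff, pull_pull]
    exacts [hp.2, le_inf hp.1 hq.1, inf_le_left, hq.2, le_inf hp.1 hq.1, inf_le_right]

theorem mk_sup_mk (x y : L) (s t : Hat Unit) :
    (⟨x, s⟩ ⊔ ⟨y, t⟩ : Twist L) = ⟨x ⊔ y, push x (x ⊔ y) s ⊔ push y (x ⊔ y) t⟩ := rfl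

theorem mk_inf_mk (x y : L) (s t : Hat Unit) :
    (⟨x, s⟩ ⊓ ⟨y, t⟩ : Twist L) = ⟨x ⊓ y, pull (x ⊓ y) x s ⊓ pull (x ⊓ y) y t⟩ := rfl

/-- The projection onto `L`. -/
def baseHom : LatticeHom (Twist L) L where
  toFun := base
  map_sup' _ _ := rfl
  map_inf' _ _ := rfl

/-- The embedding of `L` by the least elements of the copies. -/
def botHom : LatticeHom L (Twist L) where
  toFun x := ⟨x, ⊥⟩
  map_sup' x y := by simp [mk_sup_mk]
  map_inf' x y := by simp [mk_inf_mk]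

/-- The embedding of the copy over `x`. -/
def fibHom (x : L) : LatticeHom (Hat Unit) (Twist L) where
  toFun s := ⟨x, s⟩
  map_sup' s t := by
    rw [mk_sup_mk, sup_idem]
    simp
  map_inf' s t := by
    rw [mk_inf_mk, inf_idem]
    simp

variable {θ : LatCon (Twist L)}

theorem r_fib {x : L} {s t : Hat Unit} (hst : s ≠ t) (h : θ.r ⟨x, s⟩ ⟨x, t⟩) (a b : Hat Unit) :
    θ.r ⟨x, a⟩ ⟨x, b⟩ :=
  Hat.r_of_r (θ := θ.comap (fibHom x)) hst (fun _ _ hs ht => hst (hs.trans ht.symm)) h a b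

theorem exists_r_fib {p q : Twist L} (hpq : p ≠ q) (h : θ.r p q) :
    ∃ x s t, s ≠ t ∧ θ.r ⟨x, s⟩ ⟨x, t⟩ := by
  replace h := θ.r_inf_sup_iff.2 h
  have hlt := inf_lt_sup.2 hpq
  generalize p ⊓ q = u at h hlt
  generalize p ⊔ q = v at h hlt
  obtain ⟨x, s⟩ := u
  obtain ⟨y, t⟩ := v
  have hxy : x ≤ y := hlt.le.1
  by_cases hne : x = y
  · subst hne
    exact ⟨x, s, t, fun hst => hlt.ne (by rw [hst]), h⟩
  have h₁ : θ.r ⟨x, ⊤⟩ ⟨y, ⊤⟩ := by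
    simpa [mk_sup_mk, hxy] using θ.sup_comp h (θ.refl ⟨x, ⊤⟩)
  have h₂ (a : Hat Unit) (ha : a ≠ ⊤) : θ.r ⟨x, ⊥⟩ ⟨y, a⟩ := by
    have := θ.inf_comp h₁ (θ.refl ⟨y, a⟩)
    simpa [mk_inf_mk, hxy, pull, hne, ha] using this
  refine ⟨y, .left, .right, by simp, θ.trans (θ.symm (h₂ .left ?_)) (h₂ .right ?_)⟩ <;>
    exact fun h => by cases h

theorem r_of_base_eq {p q : Twist L} (hpq : p ≠ q) (h : θ.r p q) (x : L) (s t : Hat Unit) :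
    θ.r ⟨x, s⟩ ⟨x, t⟩ := by
  obtain ⟨y, a, b, hab, h⟩ := exists_r_fib hpq h
  have h₁ : θ.r ⟨y, ⊥⟩ ⟨y, ⊤⟩ := r_fib hab h _ _
  have h₂ : θ.r ⟨y ⊔ x, ⊥⟩ ⟨y ⊔ x, ⊤⟩ := by
    simpa [mk_sup_mk] using θ.sup_comp h₁ (θ.refl ⟨y ⊔ x, ⊥⟩)
  have h₃ : θ.r ⟨x, ⊥⟩ ⟨x, ⊤⟩ := by
    simpa [mk_inf_mk] using θ.inf_comp h₂ (θ.refl ⟨x, ⊤⟩)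
  exact r_fib bot_ne_top h₃ s t

end Twist

/-- If `D` has a least element `m` above `⊥`, then representability passes from `Ici m` to `D`. -/
theorem Representable.of_Ici {D : Type*} [Lattice D] [BoundedOrder D] {Q : Set D} {m : D}
    (hm : m ≠ ⊥) (hle : ∀ d, d ≠ ⊥ → m ≤ d) (hmQ : m ∈ Q) (hbot : ⊥ ∈ Q)
    (h : Representable (Set.Ici m) {d | (d : D) ∈ Q}) : Representable D Q := by
  classical
  rw [representable_iff] at h ⊢
  obtain ⟨L, _, _, c, hc, hQ⟩ := h
  obtain ⟨x₀, -⟩ := (hQ ⟨m, le_rfl⟩).1 hmQ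
  let C : Twist L → Twist L → D := fun p q => if p = q then ⊥ else c p.base q.base
  have hself (x : L) : c x x = ⊥ := by
    obtain ⟨θ, hθ⟩ := hc.exists_latCon ⊥
    exact le_bot_iff.1 ((hθ x x).1 (θ.refl x))
  have hCself (p : Twist L) : C p p = ⊥ := by simp [C]
  have hC {p q : Twist L} (hne : p ≠ q) : C p q = c p.base q.base := by simp [C, hne]
  have hne_bot (d : Set.Ici m) : (d : D) ≠ ⊥ := fun h => hm (le_bot_iff.1 (h ▸ d.2))
  have hC_le {d : D} (hd : d ≠ ⊥) (p q : Twist L) :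
      C p q ≤ d ↔ c p.base q.base ≤ ⟨d, hle d hd⟩ := by
    by_cases hpq : p = q
    · subst hpq
      simp [hCself, hself]
    · rw [hC hpq, ← Subtype.coe_le_coe]
  have hmk (x : L) : (⟨x, ⊥⟩ : Twist L) ≠ ⟨x, ⊤⟩ := by simp
  refine ⟨Twist L, inferInstance, inferInstance, C, ⟨fun d => ?_, fun θ => ?_, fun d e hde => ?_⟩,
    fun d => ?_⟩
  · by_cases hd : d = ⊥
    · refine ⟨.diag _, fun p q => ?_⟩
      by_cases hpq : p = q
      · subst hpq
        simp [hCself, LatCon.diag]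
      · simp [hC hpq, LatCon.diag, hpq, hd, hne_bot]
    · obtain ⟨θ, hθ⟩ := hc.exists_latCon ⟨d, hle d hd⟩
      exact ⟨θ.comap Twist.baseHom, fun p q => by rw [hC_le hd, ← hθ]; rfl⟩
  · by_cases hθ : ∃ p q, p ≠ q ∧ θ.r p q
    · obtain ⟨p, q, hpq, h⟩ := hθ
      obtain ⟨d, hd⟩ := hc.exists_value (θ.comap Twist.botHom)
      refine ⟨d, fun a b => ?_⟩
      have hab := Twist.r_of_base_eq hpq h
      rw [hC_le (hne_bot d), ← hd]
      exact ⟨fun h => θ.trans (hab _ _ _) (θ.trans h (hab _ _ _)),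
        fun h => θ.trans (hab _ _ _) (θ.trans h (hab _ _ _))⟩
    · push Not at hθ
      refine ⟨⊥, fun p q => ?_⟩
      by_cases hpq : p = q
      · subst hpq
        simp [hCself, θ.refl]
      · simp [hθ p q hpq, hC hpq, hne_bot]
  · by_cases hd : d = ⊥
    · simp [hd]
    have he : e ≠ ⊥ := by
      rintro rfl
      have := hde ⟨x₀, ⊥⟩ ⟨x₀, ⊤⟩
      rw [hC_le hd, hself, hC (hmk x₀)] at this
      exact hne_bot _ (le_bot_iff.1 (this bot_le))
    exact hc.dense ⟨d, hle d hd⟩ ⟨e, hle e he⟩ fun x y hxy => by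
      have := hde ⟨x, ⊥⟩ ⟨y, ⊥⟩
      rw [hC_le hd, hC_le he] at this
      exact this hxy
  · by_cases hd : d = ⊥
    · subst hd
      simp only [hbot, true_iff]
      exact ⟨⟨x₀, ⊥⟩, ⟨x₀, ⊥⟩, hCself _⟩
    · have := hQ ⟨d, hle d hd⟩
      rw [Set.mem_ofPred_eq] at this
      rw [this]
      constructor
      · rintro ⟨x, y, h⟩
        refine ⟨⟨x, ⊥⟩, ⟨y, ⊤⟩, ?_⟩
        rw [hC (by simp), h]
      · rintro ⟨p, q, h⟩
        refine ⟨p.base, q.base, Subtype.ext (Eq.trans ?_ h)⟩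
        rw [hC]
        rintro rfl
        exact hd (h ▸ hCself p)

/-- The relation on `Fin n` whose down-sets are given by the binary digits of the numbers `d i`. -/
def DigitLE {n : ℕ} (d : Fin n → ℕ) (i j : Fin n) : Prop := (d j).testBit i = true

instance {n : ℕ} (d : Fin n → ℕ) : DecidableRel (DigitLE d) :=
  fun i j => inferInstanceAs (Decidable ((d j).testBit i = true))

/-- `S` is a lower set for the relation described by `d`. -/
def IsDigitLower {n : ℕ} (d : Fin n → ℕ) (S : Finset (Fin n)) : Prop :=
  ∀ i j, DigitLE d i j → j ∈ S → i ∈ S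

instance {n : ℕ} (d : Fin n → ℕ) : DecidablePred (IsDigitLower d) :=
  fun S => inferInstanceAs (Decidable (∀ i j, DigitLE d i j → j ∈ S → i ∈ S))

/-- `g` enumerates join-irreducible elements ordered as described by `d`. -/
structure IsIrredFamily {D : Type*} [Lattice D] {k : ℕ} (d : Fin k → ℕ) (g : Fin k → D) :
    Prop where
  supIrred : ∀ j, SupIrred (g j)
  le_iff : ∀ i j, g i ≤ g j ↔ DigitLE d i j

namespace IsIrredFamily

variable {D : Type*} [DistribLattice D] [OrderBot D] {k : ℕ} {d : Fin k → ℕ} {g : Fin k → D}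

theorem le_sup_iff (hg : IsIrredFamily d g) {S : Finset (Fin k)} {j : Fin k} :
    g j ≤ S.sup g ↔ ∃ i ∈ S, DigitLE d j i := by
  rw [(hg.supIrred j).supPrime.le_finset_sup]
  simp only [hg.le_iff]

theorem le_sup_iff_mem (hg : IsIrredFamily d g) {S : Finset (Fin k)} (hS : IsDigitLower d S)
    {j : Fin k} : g j ≤ S.sup g ↔ j ∈ S :=
  ⟨fun h => by
    obtain ⟨i, hi, hji⟩ := hg.le_sup_iff.1 h
    exact hS _ _ hji hi, fun h => Finset.le_sup h⟩

theorem card_le [Fintype D] (hg : IsIrredFamily d g) :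
    (Finset.univ.filter (IsDigitLower d)).card ≤ Fintype.card D := by
  refine Finset.card_le_card_of_injOn (fun S => S.sup g) (fun _ _ => Finset.mem_univ _) ?_
  intro S hS T hT h
  simp only [Finset.coe_filter, Finset.mem_univ, true_and, Set.mem_ofPred_eq] at hS hT h
  ext j
  rw [← hg.le_sup_iff_mem hS, ← hg.le_sup_iff_mem hT, h]

theorem eq_sup [Finite D] (hall : ∀ a : D, SupIrred a → ∃ j, g j = a) (a : D) :
    open Classical in a = (Finset.univ.filter fun j => g j ≤ a).sup g := by
  classical
  apply le_antisymm
  · obtain ⟨s, rfl, hs⟩ := exists_supIrred_decomposition a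
    refine Finset.sup_le fun b hb => ?_
    obtain ⟨j, rfl⟩ := hall b (hs hb)
    exact Finset.le_sup (f := g)
      (Finset.mem_filter.2 ⟨Finset.mem_univ _, Finset.le_sup (f := id) hb⟩)
  · exact Finset.sup_le fun j hj => (Finset.mem_filter.1 hj).2

end IsIrredFamily

/-- A lattice on `Fin n`, given by down-sets `down` whose elements are listed in the order of a
linear extension, together with the order `col` of the `k` join-irreducible congruences, the largest
congruence `block j` not above the `j`-th of them, and the edges generating the `j`-th of them. -/
structure Table (k n : ℕ) where
  down : Fin n → ℕ
  col : Fin k → ℕ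
  block : Fin k → Fin n → ℕ
  edges : Fin k → List (Fin n × Fin n)

namespace Table

variable {k n : ℕ} (T : Table k n)

/-- The join: the first common upper bound. -/
def join (x y : Fin n) : Fin n :=
  ((List.finRange n).find? fun z => DigitLE T.down x z ∧ DigitLE T.down y z).getD x

/-- The meet: the last common lower bound. -/
def meet (x y : Fin n) : Fin n :=
  ((List.finRange n).reverse.find? fun z => DigitLE T.down z x ∧ DigitLE T.down z y).getD x

/-- The validity of the lattice axioms. -/
abbrev IsLattice : Prop :=
  (∀ x, DigitLE T.down x x) ∧
  (∀ x y, DigitLE T.down x y → DigitLE T.down y x → x = y) ∧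
  (∀ x y, DigitLE T.down x y → ∀ z, DigitLE T.down y z → DigitLE T.down x z) ∧
  (∀ x y, DigitLE T.down x (T.join x y) ∧ DigitLE T.down y (T.join x y) ∧
    DigitLE T.down (T.meet x y) x ∧ DigitLE T.down (T.meet x y) y) ∧
  (∀ x y z, DigitLE T.down x z → DigitLE T.down y z → DigitLE T.down (T.join x y) z) ∧
  (∀ x y z, DigitLE T.down z x → DigitLE T.down z y → DigitLE T.down z (T.meet x y))

/-- The edge `q` is contained in the join of `p` with `q.1` or in the meet of `p` with `q.2`. -/
abbrev Step (p q : Fin n × Fin n) : Prop :=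
  DigitLE T.down p.1 q.1 ∧ DigitLE T.down q.2 (T.join p.2 q.1) ∨
    DigitLE T.down q.2 p.2 ∧ DigitLE T.down (T.meet p.1 q.2) q.1

/-- Each edge of the list is connected by steps in both directions to the rest of the list. -/
def Linked : List (Fin n × Fin n) → Prop
  | [] => True
  | e :: l => (l = [] ∨ (∃ f ∈ l, T.Step e f) ∧ ∃ f ∈ l, T.Step f e) ∧ Linked l

instance : DecidablePred T.Linked := fun l => by
  induction l with
  | nil => exact .isTrue trivial
  | cons e l _ => unfold Linked; infer_instance

/-- The blocks are those of congruences. -/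
abbrev IsBlockTable : Prop :=
  ∀ j x y, T.block j x = T.block j y → ∀ z, T.block j (T.join x z) = T.block j (T.join y z) ∧
    T.block j (T.meet x z) = T.block j (T.meet y z)

/-- All the edges of the `j`-th list, which include every covering pair, generate the `j`-th
congruence. -/
abbrev IsEdgeTable : Prop :=
  (∀ x y, x ≠ y → DigitLE T.down x y →
    (∃ z, x ≠ z ∧ z ≠ y ∧ DigitLE T.down x z ∧ DigitLE T.down z y) ∨ ∃ j, (x, y) ∈ T.edges j) ∧
  (∀ j, T.edges j ≠ [] ∧ T.Linked (T.edges j) ∧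
    ∀ e ∈ T.edges j, DigitLE T.down e.1 e.2 ∧
      ∀ i, T.block i e.1 ≠ T.block i e.2 ↔ DigitLE T.col i j) ∧
  (∀ i j, DigitLE T.col i j → ∃ e ∈ T.edges j, ∃ f ∈ T.edges i, T.Step e f)

/-- The set of the join-irreducible congruences below the congruence generated by `(x, y)`. -/
def colours (x y : Fin n) : Finset (Fin k) :=
  Finset.univ.filter fun j => T.block j x ≠ T.block j y

/-- The nontrivial sets of colours of principal congruences form the list `E`, and those of
nonprincipal congruences form the list `F`. -/
abbrev Realizes (E F : List (Finset (Fin k))) : Prop :=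
  ∀ S, IsDigitLower T.col S →
    if ∃ x y, ∀ j, T.block j x ≠ T.block j y ↔ j ∈ S then
      S = ∅ ∨ S = Finset.univ ∨ (∃ j, S = Finset.univ.filter fun i => DigitLE T.col i j) ∨ S ∈ E
    else S ∈ F

/-- The table describes a lattice together with its congruences. -/
structure IsValid (E F : List (Finset (Fin k))) : Prop where
  isLattice : T.IsLattice
  isBlockTable : T.IsBlockTable
  isEdgeTable : T.IsEdgeTable
  realizes : T.Realizes E F

/-- The elements of the lattice described by a table. -/
def Carrier (_T : Table k n) : Type := Fin n

instance : Fintype T.Carrier := inferInstanceAs (Fintype (Fin n))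

variable {T} {D : Type*} [DistribLattice D] [BoundedOrder D] {g : Fin k → D}

theorem mem_colours {x y : Fin n} {j : Fin k} :
    j ∈ T.colours x y ↔ T.block j x ≠ T.block j y := by
  simp [colours]

theorem colours_sup_le_iff {x y : T.Carrier} {d : D} :
    (T.colours x y).sup g ≤ d ↔ ∀ j, T.block j x ≠ T.block j y → g j ≤ d := by
  simp [colours, Finset.sup_le_iff]

section

variable [h : Fact T.IsLattice]

instance : Lattice T.Carrier where
  le := DigitLE T.down
  le_refl := h.out.1
  le_trans x y z hxy hyz := h.out.2.2.1 x y hxy z hyz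
  le_antisymm := h.out.2.1
  sup := T.join
  inf := T.meet
  le_sup_left x y := (h.out.2.2.2.1 x y).1
  le_sup_right x y := (h.out.2.2.2.1 x y).2.1
  inf_le_left x y := (h.out.2.2.2.1 x y).2.2.1
  inf_le_right x y := (h.out.2.2.2.1 x y).2.2.2
  sup_le := h.out.2.2.2.2.1
  le_inf z x y := h.out.2.2.2.2.2 x y z

theorem join_comm (x y : Fin n) : T.join x y = T.join y x := sup_comm (α := T.Carrier) x y
theorem meet_comm (x y : Fin n) : T.meet x y = T.meet y x := inf_comm (α := T.Carrier) x y

/-- The congruence with the given blocks. -/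
def blockCon (hB : T.IsBlockTable) (j : Fin k) : LatCon T.Carrier where
  r x y := T.block j x = T.block j y
  refl _ := rfl
  symm := Eq.symm
  trans := Eq.trans
  sup_comp {a b c d} h₁ h₂ := by
    exact (hB j a b h₁ c).1.trans ((congrArg _ (join_comm b c)).trans
      ((hB j c d h₂ b).1.trans (congrArg _ (join_comm d b))))
  inf_comp {a b c d} h₁ h₂ := by
    exact (hB j a b h₁ c).2.trans ((congrArg _ (meet_comm b c)).trans
      ((hB j c d h₂ b).2.trans (congrArg _ (meet_comm d b))))

variable {θ : LatCon T.Carrier}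

theorem Step.r {p q : Fin n × Fin n} (hpq : T.Step p q) (hq : DigitLE T.down q.1 q.2)
    (hp : θ.r p.1 p.2) : θ.r q.1 q.2 := by
  obtain ⟨h₁, h₂⟩ | ⟨h₁, h₂⟩ := hpq
  · exact θ.r_of_le_of_le (θ.sup_comp hp (θ.refl q.1)) (sup_le h₁ le_rfl) hq h₂
  · exact θ.r_of_le_of_le (θ.inf_comp hp (θ.refl q.2)) h₂ hq (le_inf h₁ le_rfl)

theorem Linked.r {l : List (Fin n × Fin n)} (hl : T.Linked l)
    (hle : ∀ e ∈ l, DigitLE T.down e.1 e.2) {e f : Fin n × Fin n} (he : e ∈ l) (hf : f ∈ l)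
    (h' : θ.r e.1 e.2) : θ.r f.1 f.2 := by
  induction l generalizing e f with
  | nil => simp at he
  | cons a l ih =>
    obtain ⟨hal, hl⟩ := hl
    have hle' : ∀ e ∈ l, DigitLE T.down e.1 e.2 := fun e he => hle e (List.mem_cons_of_mem _ he)
    rcases List.mem_cons.1 he with rfl | he' <;> rcases List.mem_cons.1 hf with rfl | hf'
    · exact h'
    · obtain rfl | ⟨⟨b, hb, hs⟩, -⟩ := hal
      · simp at hf'
      · exact ih hl hle' hb hf' (Step.r hs (hle' b hb) h')
    · obtain rfl | ⟨-, b, hb, hs⟩ := hal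
      · simp at he'
      · exact Step.r hs (hle _ hf) (ih hl hle' he' hb h')
    · exact ih hl hle' he' hf' h'

theorem r_edge_of_le (hE : T.IsEdgeTable) {i j : Fin k} (hij : DigitLE T.col i j)
    {e f : Fin n × Fin n} (he : e ∈ T.edges j) (hf : f ∈ T.edges i) (h' : θ.r e.1 e.2) :
    θ.r f.1 f.2 := by
  obtain ⟨a, ha, b, hb, hs⟩ := hE.2.2 i j hij
  have hj := hE.2.1 j
  have hi := hE.2.1 i
  exact Linked.r hi.2.1 (fun e he => (hi.2.2 e he).1) hb hf
    (Step.r hs (hi.2.2 b hb).1 (Linked.r hj.2.1 (fun e he => (hj.2.2 e he).1) he ha h'))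

theorem r_iff (hB : T.IsBlockTable) (hE : T.IsEdgeTable) (hcol : ∀ j, DigitLE T.col j j)
    (x y : T.Carrier) :
    θ.r x y ↔ ∀ j, T.block j x ≠ T.block j y → ∀ e ∈ T.edges j, θ.r e.1 e.2 := by
  have key (m : ℕ) : ∀ x y : T.Carrier, x ≤ y → (Set.Icc x y).ncard = m →
      (θ.r x y ↔ ∀ j, T.block j x ≠ T.block j y → ∀ e ∈ T.edges j, θ.r e.1 e.2) := by
    induction m using Nat.strong_induction_on with
    | _ m ih =>
      rintro x y hxy rfl
      obtain rfl | hne := eq_or_ne x y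
      · simp [θ.refl]
      obtain ⟨z, hxz, hzy, hxz', hzy'⟩ | ⟨j, hj⟩ := hE.1 x y hne hxy
      · replace hxz : x < (show T.Carrier from z) := lt_of_le_of_ne hxz' hxz
        replace hzy : (show T.Carrier from z) < y := lt_of_le_of_ne hzy' hzy
        have h₁ := ih _ (Set.ncard_lt_ncard ⟨Set.Icc_subset_Icc_right hzy.le, fun hs =>
          hzy.not_ge (hs ⟨hxy, le_rfl⟩).2⟩ (Set.toFinite _)) x z hxz.le rfl
        have h₂ := ih _ (Set.ncard_lt_ncard ⟨Set.Icc_subset_Icc_left hxz.le, fun hs =>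
          hxz.not_ge (hs ⟨le_rfl, hxy⟩).1⟩ (Set.toFinite _)) z y hzy.le rfl
        rw [θ.r_iff_of_le_of_le hxz.le hzy.le, h₁, h₂, ← forall_and]
        refine forall_congr' fun j => ?_
        have := (blockCon hB j).r_iff_of_le_of_le hxz.le hzy.le
        change T.block j x = T.block j y ↔ T.block j x = T.block j z ∧ T.block j z = T.block j y
          at this
        tauto
      · constructor
        · intro hr i hi f hf
          exact r_edge_of_le hE ((((hE.2.1 j).2.2 _ hj).2 i).1 hi) hj hf hr
        · intro hr
          exact hr j ((((hE.2.1 j).2.2 _ hj).2 j).2 (hcol j)) _ hj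
  rw [← θ.r_inf_sup_iff, key _ _ _ inf_le_sup rfl]
  refine forall_congr' fun j => ?_
  have : T.block j _ = T.block j _ ↔ T.block j x = T.block j y :=
    (blockCon hB j).r_inf_sup_iff (x := x) (y := y)
  rw [Ne, this]

theorem isDigitLower_colours (hB : T.IsBlockTable) (hE : T.IsEdgeTable)
    (hcol : ∀ j, DigitLE T.col j j) (x y : T.Carrier) : IsDigitLower T.col (T.colours x y) := by
  intro i j hij hj
  simp only [colours, Finset.mem_filter, Finset.mem_univ, true_and] at hj ⊢
  intro hi
  obtain ⟨e, he⟩ := List.exists_mem_of_ne_nil _ (hE.2.1 j).1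
  exact (((hE.2.1 j).2.2 e he).2 i).2 hij
    ((r_iff (θ := blockCon hB i) hB hE hcol x y).1 hi j hj e he)

theorem isColoring [Finite D] (hB : T.IsBlockTable) (hE : T.IsEdgeTable)
    (hg : IsIrredFamily T.col g) (hall : ∀ a : D, SupIrred a → ∃ j, g j = a) :
    IsColoring fun x y : T.Carrier => (T.colours x y).sup g := by
  classical
  have hcol (j : Fin k) : DigitLE T.col j j := (hg.le_iff j j).1 le_rfl
  refine ⟨fun d => ?_, fun θ => ?_, fun d e hde => ?_⟩
  · refine ⟨sInf {θ | ∃ j, ¬ g j ≤ d ∧ θ = blockCon hB j}, fun x y => ?_⟩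
    rw [colours_sup_le_iff]
    constructor
    · intro hr j hj
      by_contra hd
      exact hj (hr _ ⟨j, hd, rfl⟩)
    · rintro hr _ ⟨j, hd, rfl⟩
      by_contra hj
      exact hd (hr j hj)
  · refine ⟨(Finset.univ.filter fun j => ∀ e ∈ T.edges j, θ.r e.1 e.2).sup g, fun x y => ?_⟩
    rw [colours_sup_le_iff, r_iff hB hE hcol]
    refine forall_congr' fun j => imp_congr_right fun _ => ?_
    rw [hg.le_sup_iff]
    simp only [Finset.mem_filter, Finset.mem_univ, true_and]
    constructor
    · intro hj
      exact ⟨j, hj, hcol j⟩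
    · rintro ⟨i, hi, hji⟩ f hf
      obtain ⟨e, he⟩ := List.exists_mem_of_ne_nil _ (hE.2.1 i).1
      exact r_edge_of_le hE hji he hf (hi e he)
  · rw [IsIrredFamily.eq_sup hall d]
    refine Finset.sup_le fun j hj => ?_
    obtain ⟨f, hf⟩ := List.exists_mem_of_ne_nil _ (hE.2.1 j).1
    have hc (d : D) : (T.colours f.1 f.2).sup g ≤ d ↔ g j ≤ d := by
      refine (colours_sup_le_iff (x := f.1) (y := f.2)).trans ?_
      simp_rw [((hE.2.1 j).2.2 f hf).2, ← hg.le_iff]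
      exact ⟨fun h => h j le_rfl, fun h i hi => hi.trans h⟩
    rw [← hc]
    exact hde _ _ ((hc d).2 (Finset.mem_filter.1 hj).2)

end

theorem IsValid.representable [Finite D] {E F : List (Finset (Fin k))} (hT : T.IsValid E F)
    (hg : IsIrredFamily T.col g) (hall : ∀ a : D, SupIrred a → ∃ j, g j = a) {Q : Set D}
    (hQ : Jplus D ⊆ Q) (hEQ : ∀ S ∈ E, S.sup g ∈ Q) (hFQ : ∀ S ∈ F, S.sup g ∉ Q) :
    Representable D Q := by
  classical
  obtain ⟨h, hB, hE, hT⟩ := hT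
  have : Fact T.IsLattice := ⟨h⟩
  rw [representable_iff]
  refine ⟨T.Carrier, inferInstance, inferInstance, _, isColoring hB hE hg hall, fun d => ?_⟩
  have hcol (j : Fin k) : DigitLE T.col j j := (hg.le_iff j j).1 le_rfl
  have hd := IsIrredFamily.eq_sup hall d
  set S : Finset (Fin k) := Finset.univ.filter fun j => g j ≤ d with hS
  have hlow : IsDigitLower T.col S := fun i j hij hj => by
    simp only [hS, Finset.mem_filter, Finset.mem_univ, true_and] at hj ⊢
    exact ((hg.le_iff i j).2 hij).trans hj
  have hT' := hT S hlow
  simp only [← mem_colours, ← Finset.ext_iff] at hT'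
  constructor
  · intro hdQ
    split_ifs at hT' with hex
    · obtain ⟨x, y, hxy⟩ := hex
      exact ⟨x, y, by rw [hd, ← hxy]⟩
    · exact absurd (hd ▸ hdQ) (hFQ S hT')
  · rintro ⟨x, y, hxy⟩
    have hSxy : T.colours x y = S := by
      ext j
      rw [← hg.le_sup_iff_mem (isDigitLower_colours hB hE hcol x y), hxy]
      simp [hS]
    rw [if_pos ⟨x, y, hSxy⟩] at hT'
    rw [hd]
    obtain hS | hS | ⟨j, hS⟩ | hS := hT'
    · exact hQ (Or.inl (Or.inl (by rw [hS, Finset.sup_empty])))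
    · refine hQ (Or.inl (Or.inr ?_))
      rw [hS, Set.mem_singleton_iff, ← top_le_iff, IsIrredFamily.eq_sup hall (⊤ : D)]
      exact Finset.sup_mono (Finset.subset_univ _)
    · have : S.sup g = g j := by
        apply le_antisymm
        · refine Finset.sup_le fun i hi => (hg.le_iff i j).2 ?_
          simpa [hS] using hi
        · refine Finset.le_sup ?_
          simpa [hS] using hcol j
      rw [this]
      exact hQ (Or.inr (hg.supIrred j))
    · exact hEQ S hS

end Table

set_option synthInstance.maxSize 2000

namespace Table

/-- Two incomparable colours. -/
def antichain : Table 2 3 where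
  down := ![1, 3, 7]
  col := ![1, 2]
  block := ![![0, 1, 1], ![0, 0, 2]]
  edges := ![[(0, 1)], [(1, 2)]]

theorem antichain_isValid : antichain.IsValid [] [] := by
  constructor <;> decide +kernel

/-- Two incomparable colours and a top colour; the join of the two former is not principal. -/
def wedge : Table 3 7 where
  down := ![1, 3, 7, 9, 25, 33, 127]
  col := ![1, 2, 7]
  block := ![![0, 1, 2, 3, 3, 5, 6], ![0, 1, 1, 3, 4, 5, 6], ![0, 1, 1, 3, 3, 5, 6]]
  edges := ![[(1, 2)], [(3, 4)], [(5, 6), (0, 1), (4, 6), (0, 3), (2, 6), (0, 5)]]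

theorem wedge_isValid : wedge.IsValid [] [{0, 1}] := by
  constructor <;> decide +kernel

/-- Two comparable colours and an isolated one; the join of the two minimal colours is not
principal. -/
def chainPoint : Table 3 7 where
  down := ![1, 3, 7, 9, 17, 63, 127]
  col := ![1, 2, 5]
  block := ![![0, 1, 2, 3, 4, 5, 5], ![0, 0, 0, 0, 0, 0, 6], ![0, 1, 1, 3, 4, 5, 5]]
  edges := ![[(1, 2)], [(5, 6)], [(4, 5), (0, 1), (3, 5), (0, 4), (2, 5), (0, 3)]]

theorem chainPoint_isValid : chainPoint.IsValid [] [{0, 1}] := by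
  constructor <;> decide +kernel

/-- Two comparable colours and an isolated one; the join of the two minimal colours is principal. -/
def chainPointJoin : Table 3 8 where
  down := ![1, 3, 5, 9, 31, 33, 127, 255]
  col := ![1, 2, 5]
  block := ![![0, 1, 2, 3, 4, 5, 6, 6], ![0, 0, 0, 0, 0, 0, 0, 7], ![0, 0, 0, 0, 0, 5, 5, 5]]
  edges := ![[(5, 6), (3, 4), (0, 2), (1, 4), (0, 3), (2, 4), (0, 1)], [(6, 7)], [(4, 6), (0, 5)]]

theorem chainPointJoin_isValid : chainPointJoin.IsValid [{0, 1}] [] := by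
  constructor <;> decide +kernel

/-- Two comparable colours, an isolated one, and a top colour; the join of the two minimal colours
is not principal. -/
def chainPointTop : Table 4 11 where
  down := ![1, 3, 7, 15, 19, 35, 127, 129, 385, 513, 2047]
  col := ![1, 2, 5, 15]
  block := ![![0, 1, 2, 3, 4, 5, 6, 7, 7, 9, 10], ![0, 1, 1, 1, 1, 1, 1, 7, 8, 9, 10],
    ![0, 1, 2, 2, 4, 5, 6, 7, 7, 9, 10], ![0, 1, 1, 1, 1, 1, 1, 7, 7, 9, 10]]
  edges := ![[(2, 3)], [(7, 8)], [(5, 6), (1, 4), (3, 6), (1, 5), (4, 6), (1, 2)],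
    [(9, 10), (0, 1), (8, 10), (0, 7), (6, 10), (0, 9)]]

theorem chainPointTop_isValid : chainPointTop.IsValid [] [{0, 1}, {0, 1, 2}] := by
  constructor <;> decide +kernel

/-- Two comparable colours, an isolated one, and a top colour; the join of the two minimal colours
is principal. -/
def chainPointTopJoin : Table 4 13 where
  down := ![1, 3, 7, 15, 19, 63, 71, 207, 327, 975, 1025, 2049, 8191]
  col := ![1, 2, 5, 15]
  block := ![![0, 1, 2, 3, 4, 5, 6, 7, 6, 7, 10, 11, 12],
    ![0, 1, 1, 1, 4, 4, 6, 6, 8, 8, 10, 11, 12],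
    ![0, 1, 2, 2, 4, 5, 6, 6, 6, 6, 10, 11, 12], ![0, 1, 1, 1, 4, 4, 6, 6, 6, 6, 10, 11, 12]]
  edges := ![[(8, 9), (6, 7), (2, 3)], [(7, 9), (6, 8)], [(4, 5), (1, 2)],
    [(11, 12), (0, 1), (10, 12), (3, 5), (1, 4), (9, 12), (3, 7), (2, 6), (0, 11), (5, 12),
      (0, 10)]]

theorem chainPointTopJoin_isValid : chainPointTopJoin.IsValid [{0, 1}] [{0, 1, 2}] := by
  constructor <;> decide +kernel

/-- Two minimal colours below two maximal ones; the join of the two minimal colours is principal. -/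
def crownJoin : Table 4 6 where
  down := ![1, 3, 7, 15, 17, 63]
  col := ![1, 2, 7, 11]
  block := ![![0, 1, 2, 2, 4, 5], ![0, 1, 1, 3, 4, 5], ![0, 1, 1, 1, 0, 1], ![0, 0, 0, 0, 4, 4]]
  edges := ![[(1, 2)], [(2, 3)], [(4, 5), (0, 1)], [(3, 5), (0, 4)]]

theorem crownJoin_isValid : crownJoin.IsValid [{0, 1}] [] := by
  constructor <;> decide +kernel

/-- Two minimal colours below two maximal ones; the join of the two minimal colours is not
principal. -/
def crown : Table 4 6 where
  down := ![1, 3, 7, 9, 25, 63]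
  col := ![1, 2, 7, 11]
  block := ![![0, 1, 2, 3, 3, 5], ![0, 1, 1, 3, 4, 5], ![0, 1, 1, 0, 0, 1], ![0, 0, 0, 3, 3, 3]]
  edges := ![[(1, 2)], [(3, 4)], [(4, 5), (0, 1)], [(2, 5), (0, 3)]]

theorem crown_isValid : crown.IsValid [] [{0, 1}] := by
  constructor <;> decide +kernel

end Table

namespace IsIrredFamily

variable {D : Type*} [DistribLattice D] [OrderBot D] [Fintype D] {k : ℕ} {d : Fin k → ℕ}
  {g : Fin k → D}

/-- A family with at least as many lower sets as `D` has elements contains every join-irreducible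
element. -/
theorem exists_eq (hg : IsIrredFamily d g)
    (h : Fintype.card D ≤ (Finset.univ.filter (IsDigitLower d)).card) {a : D} (ha : SupIrred a) :
    ∃ j, g j = a := by
  obtain ⟨S, -, hS⟩ := Finset.surj_on_of_inj_on_of_card_le (t := (Finset.univ : Finset D))
    (s := Finset.univ.filter (IsDigitLower d)) (fun S _ => S.sup g) (fun _ _ => Finset.mem_univ _)
    (fun S T hS hT h => by
      rw [Finset.mem_filter] at hS hT
      ext j
      rw [← hg.le_sup_iff_mem hS.2, ← hg.le_sup_iff_mem hT.2, h]) h a (Finset.mem_univ _)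
  obtain ⟨j, -, hj⟩ := ha.finset_sup_eq hS.symm
  exact ⟨j, hj⟩

end IsIrredFamily

theorem le_of_forall_supIrred_le {D : Type*} [Lattice D] [OrderBot D] [Finite D] {d e : D}
    (h : ∀ a, SupIrred a → a ≤ d → a ≤ e) : d ≤ e := by
  obtain ⟨s, rfl, hs⟩ := exists_supIrred_decomposition d
  exact Finset.sup_le fun a ha => h a (hs ha) (Finset.le_sup (f := id) ha)

section

variable {D : Type*} [DistribLattice D] [BoundedOrder D] [Fintype D] {Q : Set D} {p q r : D}

/-- Representability when `q` is minimal, `p < r` are incomparable to `q`, and no element of `Q` is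
the unique coatom of `D`. -/
theorem representable_of_lt_of_not_le (hD : Fintype.card D ≤ 7) (hQ : Jplus D ⊆ Q)
    (hco : ∀ u ∈ Q, u ≠ ⊤ → ∃ d, d ≠ ⊤ ∧ ¬ d ≤ u) (hp : SupIrred p) (hq : SupIrred q)
    (hr : SupIrred r) (hmin : ∀ a, SupIrred a → p ≤ a ∨ q ≤ a) (hqp : ¬ q ≤ p) (hpq : ¬ p ≤ q)
    (hpr : p < r) (hqr : ¬ q ≤ r) : Representable D Q := by
  have hpr' := hpr.le
  have hrp := hpr.not_ge
  have hrq : ¬ r ≤ q := fun h => hpq (hpr'.trans h)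
  have forbidden {k : ℕ} {d : Fin k → ℕ} {g : Fin k → D} (hg : IsIrredFamily d g)
      (h : 7 < (Finset.univ.filter (IsDigitLower d)).card) : False :=
    (h.trans_le (hg.card_le.trans hD)).false
  have hcase (a : D) (ha : SupIrred a) : a = p ∨ a = q ∨ a = r ∨ r < a ∧ q ≤ a := by
    by_contra! hne
    obtain ⟨hap, haq, har, hra⟩ := hne
    by_cases hpa : p ≤ a
    · have hap' : ¬ a ≤ p := fun h => hap (h.antisymm hpa)
      have haq' : ¬ a ≤ q := fun h => hpq (hpa.trans h)
      by_cases hqa : q ≤ a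
      · have hra' : ¬ r ≤ a := fun h => hra (lt_of_le_of_ne h (Ne.symm har)) hqa
        have har' : ¬ a ≤ r := fun h => hqr (hqa.trans h)
        exact forbidden (d := ![1, 2, 5, 11]) (g := ![p, q, r, a])
          (by constructor <;> simp [Fin.forall_fin_succ, DigitLE, Nat.testBit, *])
          (by decide +kernel)
      · by_cases hra' : r ≤ a <;> by_cases har' : a ≤ r
        · exact har (har'.antisymm hra')
        · exact forbidden (d := ![1, 2, 5, 13]) (g := ![p, q, r, a])
            (by constructor <;> simp [Fin.forall_fin_succ, DigitLE, Nat.testBit, *])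
            (by decide +kernel)
        · exact forbidden (d := ![1, 2, 13, 9]) (g := ![p, q, r, a])
            (by constructor <;> simp [Fin.forall_fin_succ, DigitLE, Nat.testBit, *])
            (by decide +kernel)
        · exact forbidden (d := ![1, 2, 5, 9]) (g := ![p, q, r, a])
            (by constructor <;> simp [Fin.forall_fin_succ, DigitLE, Nat.testBit, *])
            (by decide +kernel)
    · have hqa := (hmin a ha).resolve_left hpa
      have haq' : ¬ a ≤ q := fun h => haq (h.antisymm hqa)
      have hap' : ¬ a ≤ p := fun h => hqp (hqa.trans h)
      have hra' : ¬ r ≤ a := fun h => hpa (hpr'.trans h)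
      have har' : ¬ a ≤ r := fun h => hqr (hqa.trans h)
      exact forbidden (d := ![1, 2, 5, 10]) (g := ![p, q, r, a])
        (by constructor <;> simp [Fin.forall_fin_succ, DigitLE, Nat.testBit, *])
        (by decide +kernel)
  by_cases hz : ∃ z, SupIrred z ∧ r < z ∧ q ≤ z
  · obtain ⟨z, hz, hrz, hqz⟩ := hz
    have hrz' := hrz.le
    have hzr := hrz.not_ge
    have hpz := hpr'.trans hrz'
    have hzp : ¬ z ≤ p := fun h => hqp (hqz.trans h)
    have hzq : ¬ z ≤ q := fun h => hrq (hrz'.trans h)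
    have hg : IsIrredFamily ![1, 2, 5, 15] ![p, q, r, z] := by
      constructor <;> simp [Fin.forall_fin_succ, DigitLE, Nat.testBit, *]
    have hall (a : D) (ha : SupIrred a) : ∃ j, ![p, q, r, z] j = a :=
      hg.exists_eq (hD.trans (by decide +kernel)) ha
    have hall' (a : D) (ha : SupIrred a) : a ≤ z ∧ (a = z ∨ a ≤ r ⊔ q) := by
      obtain ⟨j, rfl⟩ := hall a ha
      fin_cases j <;> simp [hpz, hqz, hrz', le_sup_of_le_left hpr']
    have hrqQ : r ⊔ q ∉ Q := by
      intro hmem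
      obtain ⟨d, hd, hdu⟩ := hco _ hmem fun h => by
        have : z ≤ r ⊔ q := h ▸ le_top
        exact (hz.supPrime.le_sup.1 this).elim hzr hzq
      refine hdu (le_of_forall_supIrred_le fun a ha had => ?_)
      refine (hall' a ha).2.resolve_left ?_
      rintro rfl
      exact hd (top_le_iff.1 ((le_of_forall_supIrred_le fun b hb _ => (hall' b hb).1).trans had))
    have hsup : p ⊔ (q ⊔ r) = r ⊔ q := by
      rw [← sup_assoc, sup_right_comm, sup_eq_right.2 hpr']
    by_cases hpqQ : p ⊔ q ∈ Q
    · exact Table.chainPointTopJoin_isValid.representable hg hall hQ (by simpa using hpqQ)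
        (by simpa [hsup] using hrqQ)
    · exact Table.chainPointTop_isValid.representable hg hall hQ (by simp)
        (by simpa [hsup] using ⟨hpqQ, hrqQ⟩)
  · push Not at hz
    have hg : IsIrredFamily ![1, 2, 5] ![p, q, r] := by
      constructor <;> simp [Fin.forall_fin_succ, DigitLE, Nat.testBit, *]
    have hall (a : D) (ha : SupIrred a) : ∃ j, ![p, q, r] j = a := by
      obtain rfl | rfl | rfl | ⟨h, h'⟩ := hcase a ha
      exacts [⟨0, rfl⟩, ⟨1, rfl⟩, ⟨2, rfl⟩, (hz a ha h h').elim]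
    by_cases hpqQ : p ⊔ q ∈ Q
    · exact Table.chainPointJoin_isValid.representable hg hall hQ (by simpa using hpqQ) (by simp)
    · exact Table.chainPoint_isValid.representable hg hall hQ (by simp) (by simpa using hpqQ)

/-- Representability when all the join-irreducible elements except `p` and `q` are above both, and
no element of `Q` is the unique coatom of `D`. -/
theorem representable_of_forall_le (hD : Fintype.card D ≤ 7) (hQ : Jplus D ⊆ Q)
    (hco : ∀ u ∈ Q, u ≠ ⊤ → ∃ d, d ≠ ⊤ ∧ ¬ d ≤ u) (hp : SupIrred p) (hq : SupIrred q)
    (hqp : ¬ q ≤ p) (hpq : ¬ p ≤ q) (hcase : ∀ a, SupIrred a → a = p ∨ a = q ∨ p ≤ a ∧ q ≤ a) :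
    Representable D Q := by
  have hbelow {z : D} (hpz : p ≤ z) (hqz : q ≤ z) : ¬ z ≤ p ∧ ¬ z ≤ q :=
    ⟨fun h => hqp (hqz.trans h), fun h => hpq (hpz.trans h)⟩
  by_cases hne : ∃ z, SupIrred z ∧ p ≤ z ∧ q ≤ z
  swap
  · push Not at hne
    refine Table.antichain_isValid.representable (g := ![p, q])
      (by constructor <;> simp [Table.antichain, Fin.forall_fin_succ, DigitLE, Nat.testBit, *])
      (fun a ha => ?_) hQ (by simp) (by simp)
    obtain rfl | rfl | ⟨h, h'⟩ := hcase a ha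
    exacts [⟨0, rfl⟩, ⟨1, rfl⟩, (hne a ha h h').elim]
  by_cases hinc : ∃ z w, SupIrred z ∧ SupIrred w ∧ (p ≤ z ∧ q ≤ z) ∧ (p ≤ w ∧ q ≤ w) ∧
      ¬ z ≤ w ∧ ¬ w ≤ z
  · obtain ⟨z, w, hz, hw, ⟨hpz, hqz⟩, ⟨hpw, hqw⟩, hzw, hwz⟩ := hinc
    obtain ⟨hzp, hzq⟩ := hbelow hpz hqz
    obtain ⟨hwp, hwq⟩ := hbelow hpw hqw
    have hg : IsIrredFamily ![1, 2, 7, 11] ![p, q, z, w] := by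
      constructor <;> simp [Fin.forall_fin_succ, DigitLE, Nat.testBit, *]
    have hall (a : D) (ha : SupIrred a) : ∃ j, ![p, q, z, w] j = a :=
      hg.exists_eq (hD.trans (by decide +kernel)) ha
    by_cases hpqQ : p ⊔ q ∈ Q
    · exact Table.crownJoin_isValid.representable hg hall hQ (by simpa using hpqQ) (by simp)
    · exact Table.crown_isValid.representable hg hall hQ (by simp) (by simpa using hpqQ)
  push Not at hinc
  have greatest (S : Set D) (hS : ∀ z ∈ S, SupIrred z ∧ p ≤ z ∧ q ≤ z) (hne : S.Nonempty) :
      ∃ z ∈ S, ∀ w ∈ S, w ≤ z := by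
    obtain ⟨z, hz⟩ := S.toFinite.exists_maximal hne
    refine ⟨z, hz.prop, fun w hw => ?_⟩
    by_contra hwz
    by_cases hzw : z ≤ w
    · exact hwz (hz.le_of_ge hw hzw)
    · exact hwz (hinc z w (hS z hz.prop).1 (hS w hw).1 (hS z hz.prop).2 (hS w hw).2 hzw)
  obtain ⟨z, ⟨hz, hpz, hqz⟩, hmax⟩ :=
    greatest {z | SupIrred z ∧ p ≤ z ∧ q ≤ z} (fun _ h => h) hne
  obtain ⟨hzp, hzq⟩ := hbelow hpz hqz
  have hle (a : D) (ha : SupIrred a) : a ≤ z := by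
    obtain rfl | rfl | h := hcase a ha
    exacts [hpz, hqz, hmax a ⟨ha, h⟩]
  have hztop : z = ⊤ := top_le_iff.1 (le_of_forall_supIrred_le fun a ha _ => hle a ha)
  by_cases hne' : ∃ w, (SupIrred w ∧ p ≤ w ∧ q ≤ w) ∧ w ≠ z
  · obtain ⟨w, ⟨⟨hw, hpw, hqw⟩, hwz⟩, hmax'⟩ :=
      greatest {w | (SupIrred w ∧ p ≤ w ∧ q ≤ w) ∧ w ≠ z} (fun _ h => h.1) hne'
    obtain ⟨d, hd, hdw⟩ := hco w (hQ (Or.inr hw)) (hztop ▸ hwz)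
    refine (hdw (le_of_forall_supIrred_le fun a ha had => ?_)).elim
    obtain rfl | rfl | h := hcase a ha
    · exact hpw
    · exact hqw
    · refine hmax' a ⟨⟨ha, h⟩, ?_⟩
      rintro rfl
      exact hd (top_le_iff.1 (hztop ▸ had))
  · push Not at hne'
    have hpqQ : p ⊔ q ∉ Q := by
      intro hmem
      obtain ⟨d, hd, hdu⟩ := hco _ hmem fun h => by
        have : z ≤ p ⊔ q := h ▸ le_top
        exact (hz.supPrime.le_sup.1 this).elim hzp hzq
      refine hdu (le_of_forall_supIrred_le fun a ha had => ?_)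
      obtain rfl | rfl | h := hcase a ha
      · exact le_sup_left
      · exact le_sup_right
      · exact (hd (top_le_iff.1 (hztop ▸ hne' a ⟨ha, h⟩ ▸ had))).elim
    refine Table.wedge_isValid.representable (g := ![p, q, z])
      (by
        clear hztop
        constructor <;> simp [Table.wedge, Fin.forall_fin_succ, DigitLE, Nat.testBit, *])
      (fun a ha => ?_) hQ (by simp) (by simpa using hpqQ)
    obtain rfl | rfl | h := hcase a ha
    exacts [⟨0, rfl⟩, ⟨1, rfl⟩, ⟨2, (hne' a ⟨ha, h⟩).symm⟩]

/-- Representability when neither a nonzero element is below all the others nor an element of `Q` is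
the unique coatom of `D`. -/
theorem representable_of_forall_exists [Nontrivial D] (hD : Fintype.card D ≤ 7)
    (hQ : Jplus D ⊆ Q) (hat : ∀ m : D, m ≠ ⊥ → ∃ d, d ≠ ⊥ ∧ ¬ m ≤ d)
    (hco : ∀ u ∈ Q, u ≠ ⊤ → ∃ d, d ≠ ⊤ ∧ ¬ d ≤ u) : Representable D Q := by
  have irred {a : D} (ha : IsAtom a) : SupIrred a := by
    refine ⟨fun h => ha.1 h.eq_bot, fun b c h => ?_⟩
    obtain hb | hb := ha.le_iff.1 (h ▸ le_sup_left : b ≤ a)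
    · exact Or.inr (by rw [← h, hb, bot_sup_eq])
    · exact Or.inl hb
  obtain ⟨p, hp, -⟩ := (eq_bot_or_exists_atom_le (⊤ : D)).resolve_left top_ne_bot
  obtain ⟨d, hd, hpd⟩ := hat p hp.1
  obtain ⟨q, hq, hqd⟩ := (eq_bot_or_exists_atom_le d).resolve_left hd
  have hpq : ¬ p ≤ q := fun h => hpd (h.trans hqd)
  have hqp : ¬ q ≤ p := fun h => hpq ((hp.le_iff_eq hq.1).1 h).ge
  have hmin (a : D) (ha : SupIrred a) : p ≤ a ∨ q ≤ a := by
    obtain ⟨b, hb, hba⟩ := (eq_bot_or_exists_atom_le a).resolve_left ha.ne_bot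
    by_contra! h
    have hpb : ¬ p ≤ b := fun h' => h.1 (h'.trans hba)
    have hqb : ¬ q ≤ b := fun h' => h.2 (h'.trans hba)
    have hbp : ¬ b ≤ p := fun h => hpb ((hp.le_iff_eq hb.1).1 h).ge
    have hbq : ¬ b ≤ q := fun h => hqb ((hq.le_iff_eq hb.1).1 h).ge
    have hp' := irred hp
    have hq' := irred hq
    have hb' := irred hb
    have hg : IsIrredFamily ![1, 2, 4] ![p, q, b] := by
      constructor <;> simp [Fin.forall_fin_succ, DigitLE, Nat.testBit, *]
    exact absurd (hg.card_le.trans hD) (by decide +kernel)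
  by_cases hr : ∃ r, SupIrred r ∧ p < r ∧ ¬ q ≤ r
  · obtain ⟨r, hr, hpr, hqr⟩ := hr
    exact representable_of_lt_of_not_le hD hQ hco (irred hp) (irred hq) hr hmin hqp hpq hpr hqr
  by_cases hs : ∃ s, SupIrred s ∧ q < s ∧ ¬ p ≤ s
  · obtain ⟨s, hs, hqs, hps⟩ := hs
    exact representable_of_lt_of_not_le hD hQ hco (irred hq) (irred hp) hs
      (fun a ha => (hmin a ha).symm) hpq hqp hqs hps
  push Not at hr hs
  refine representable_of_forall_le hD hQ hco (irred hp) (irred hq) hqp hpq fun a ha => ?_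
  by_cases hap : a = p
  · exact Or.inl hap
  by_cases haq : a = q
  · exact Or.inr (Or.inl haq)
  refine Or.inr (Or.inr ?_)
  obtain h | h := hmin a ha
  · exact ⟨h, hr a ha (lt_of_le_of_ne h (Ne.symm hap))⟩
  · exact ⟨hs a ha (lt_of_le_of_ne h (Ne.symm haq)), h⟩

end

theorem representable_of_subsingleton {D : Type*} [Lattice D] [BoundedOrder D] [Subsingleton D]
    {Q : Set D} (hQ : ⊥ ∈ Q) : Representable D Q := by
  have heq (d e : D) : d = e := Subsingleton.elim d e
  refine representable_iff.2 ⟨Unit, inferInstance, inferInstance, fun _ _ => ⊥,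
    ⟨fun d => ⟨⊤, fun x y => ?_⟩, fun θ => ⟨⊥, fun x y => ?_⟩, fun d e _ => (heq d e).le⟩,
    fun d => ?_⟩
  · exact iff_of_true ((⊤ : LatCon Unit).refl x) bot_le
  · exact iff_of_true (θ.refl x) le_rfl
  · exact iff_of_true (heq ⊥ d ▸ hQ) ⟨(), (), heq _ _⟩

theorem Representable.of_jplus_subset {D : Type u} [DistribLattice D] [Fintype D] [BoundedOrder D]
    (hD : Fintype.card D ≤ 7) {Q : Set D} (hQ : Jplus D ⊆ Q) : Representable D Q := by
  classical
  induction hn : Fintype.card D using Nat.strong_induction_on generalizing D with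
  | _ n ih =>
    subst hn
    cases subsingleton_or_nontrivial D
    · exact representable_of_subsingleton (hQ (.inl (.inl rfl)))
    by_cases hat : ∃ m : D, m ≠ ⊥ ∧ ∀ d, d ≠ ⊥ → m ≤ d
    · obtain ⟨m, hm, hle⟩ := hat
      have hmirr : SupIrred m := by
        refine ⟨fun h => hm h.eq_bot, fun b c h => ?_⟩
        by_cases hb : b = ⊥
        · exact .inr (by rw [← h, hb, bot_sup_eq])
        · exact .inl ((h ▸ le_sup_left : b ≤ m).antisymm (hle b hb))
      have hmQ := hQ (.inr hmirr)
      have hcard : Fintype.card (Set.Ici m) < Fintype.card D :=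
        Fintype.card_subtype_lt (p := (· ∈ Set.Ici m)) fun h : m ≤ ⊥ => hm (le_bot_iff.1 h)
      refine .of_Ici hm hle hmQ (hQ (.inl (.inl rfl)))
        (ih _ hcard (hcard.le.trans hD) ?_ rfl)
      rintro ⟨d, hd⟩ ((h | h) | h)
      · change d ∈ Q
        rw [show d = m from congrArg Subtype.val h]
        exact hmQ
      · change d ∈ Q
        rw [show d = ⊤ from congrArg Subtype.val h]
        exact hQ (.inl (.inr rfl))
      · refine hQ (.inr ⟨fun hmin => h.1 fun e he => hmin he, fun b c hbc => ?_⟩)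
        have := @h.2 ⟨b ⊔ m, le_sup_right⟩ ⟨c ⊔ m, le_sup_right⟩
          (Subtype.ext (by simpa [← sup_sup_distrib_right, hbc] using hd))
        by_cases hb : b = ⊥
        · exact .inr (by rw [← hbc, hb, bot_sup_eq])
        by_cases hc : c = ⊥
        · exact .inl (by rw [← hbc, hc, sup_bot_eq])
        simpa [hle b hb, hle c hc] using this
    by_cases hco : ∃ u ∈ Q, u ≠ ⊤ ∧ ∀ d, d ≠ ⊤ → d ≤ u
    · obtain ⟨u, huQ, hu, hle⟩ := hco
      have hcard : Fintype.card (Set.Iic u) < Fintype.card D :=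
        Fintype.card_subtype_lt (p := (· ∈ Set.Iic u)) fun h : ⊤ ≤ u => hu (top_le_iff.1 h)
      let _ : DistribLattice (Set.Iic u) :=
        { (inferInstance : Lattice (Set.Iic u)) with
          le_sup_inf := fun a b c => le_sup_inf (α := D) (x := a) (y := b) (z := c) }
      refine .of_Iic hu hle huQ (hQ (.inl (.inr rfl)))
        (ih _ hcard (hcard.le.trans hD) ?_ rfl)
      rintro ⟨d, hd⟩ ((h | h) | h)
      · change d ∈ Q
        rw [show d = ⊥ from congrArg Subtype.val h]
        exact hQ (.inl (.inl rfl))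
      · change d ∈ Q
        rw [show d = u from congrArg Subtype.val h]
        exact huQ
      · refine hQ (.inr ⟨fun hmin => h.1 fun e he => hmin he, fun b c hbc => ?_⟩)
        have := @h.2 ⟨b, (le_sup_left.trans hbc.le).trans hd⟩
          ⟨c, (le_sup_right.trans hbc.le).trans hd⟩ (Subtype.ext hbc)
        exact this.imp (congrArg Subtype.val) (congrArg Subtype.val)
    push Not at hat hco
    exact representable_of_forall_exists hD hQ hat hco

/-- **Theorem 9.** Every finite distributive lattice with at most `7` elements is
fully representable. -/
theorem fullyRepresentable_of_card_le_seven
    (D : Type*) [DistribLattice D] [Fintype D] [BoundedOrder D]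
    (h : Fintype.card D ≤ 7) :
    FullyRepresentable D :=
  fun _ hQ => .of_jplus_subset h hQ
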